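/- Let a > 0 be real and let α be a real number with 0 < |α| < 1/2. Then ∫₀^∞ x K_α⁴(a x) dx = −(π²/(16a²)) csc²(πα) · { ψ(1/2 − α) + ψ(1/2 + α) + 4 ln 2 + 2γ }. -/

import Mathlib

open MeasureTheory Real

noncomputable def besselK (ν x : ℝ) : ℝ :=
  ∫ t in Set.Ioi (0:ℝ), Real.exp (-x * Real.cosh t) * Real.cosh (ν * t)
noncomputable def digamma (x : ℝ) : ℝ := deriv (fun y => Real.log (Real.Gamma y)) x

open scoped ENNReal

theorem setLIntegral_ofReal_of_integral_eq {f : ℝ → ℝ} {s : Set ℝ} {c : ℝ} (hs : MeasurableSet s)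
    (hf : ∀ x ∈ s, 0 ≤ f x) (h : ∫ x in s, f x = c) (hc : c ≠ 0) :
    ∫⁻ x in s, ENNReal.ofReal (f x) = ENNReal.ofReal c := by
  have hi : IntegrableOn f s := by
    by_contra hn
    exact hc (by rw [← h, integral_undef hn])
  rw [← h, ofReal_integral_eq_lintegral_ofReal hi (ae_restrict_of_forall_mem hs hf)]

theorem lintegral_rpow_mul_exp_neg_mul_Ioi {a r : ℝ} (ha : 0 < a) (hr : 0 < r) :
    ∫⁻ x in Set.Ioi (0:ℝ), ENNReal.ofReal (x ^ (a - 1) * exp (-(r * x)))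
      = ENNReal.ofReal ((1 / r) ^ a * Gamma a) := by
  refine setLIntegral_ofReal_of_integral_eq measurableSet_Ioi (fun x hx => ?_)
    (integral_rpow_mul_exp_neg_mul_Ioi ha hr) ?_
  · have : 0 < x := hx
    positivity
  · have := Gamma_pos_of_pos ha
    positivity

theorem lintegral_exp_neg_mul_Ioi {c : ℝ} (hc : 0 < c) :
    ∫⁻ x in Set.Ioi (0:ℝ), ENNReal.ofReal (exp (-(c * x))) = ENNReal.ofReal (1 / c) := by
  simpa using lintegral_rpow_mul_exp_neg_mul_Ioi one_pos hc

theorem lintegral_mul_exp_neg_mul_sq_Ioi {c : ℝ} (hc : 0 < c) :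
    ∫⁻ x in Set.Ioi (0:ℝ), ENNReal.ofReal (x * exp (-(c * x ^ 2 / 2)))
      = ENNReal.ofReal (1 / c) := by
  have h := integral_rpow_mul_exp_neg_mul_rpow (p := 2) (q := 1) (b := c / 2) (by norm_num)
    (by norm_num) (by positivity)
  refine setLIntegral_ofReal_of_integral_eq measurableSet_Ioi (fun x hx => ?_) ?_ (by positivity)
  · have : 0 < x := hx
    positivity
  · norm_num at h
    rw [rpow_neg_one] at h
    rw [one_div, show c⁻¹ = (c / 2)⁻¹ * (1 / 2) by field_simp, ← h]
    congr 1 with x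
    ring_nf

theorem lintegral_Ioi_eq_lintegral_comp_exp (f : ℝ → ℝ≥0∞) :
    ∫⁻ x in Set.Ioi (0:ℝ), f x = ∫⁻ r, ENNReal.ofReal (exp r) * f (exp r) := by
  have := lintegral_image_eq_lintegral_abs_deriv_mul MeasurableSet.univ
    (fun x _ => (Real.hasDerivAt_exp x).hasDerivWithinAt) Real.exp_injective.injOn f
  simpa [Set.image_univ, Real.range_exp] using this

theorem lintegral_Ioi_eq_lintegral_comp_cosh_sub_one (f : ℝ → ℝ≥0∞) :
    ∫⁻ x in Set.Ioi (0:ℝ), f x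
      = ∫⁻ p in Set.Ioi (0:ℝ), ENNReal.ofReal (sinh p) * f (cosh p - 1) := by
  have hinj : Set.InjOn (fun p => cosh p - 1) (Set.Ioi 0) := fun x hx y hy h =>
    Real.cosh_strictMonoOn.injOn (Set.Ioi_subset_Ici_self hx) (Set.Ioi_subset_Ici_self hy)
      (sub_left_injective h)
  have himg : (fun p => cosh p - 1) '' Set.Ioi (0:ℝ) = Set.Ioi 0 := by
    ext y
    refine ⟨?_, fun hy => ⟨arcosh (y + 1), ?_, ?_⟩⟩
    · rintro ⟨p, hp, rfl⟩
      have : 1 < cosh p := Real.one_lt_cosh.2 (ne_of_gt hp)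
      simpa using this
    · exact Real.arcosh_pos (by simpa using hy)
    · have : 0 < y := hy
      simp [Real.cosh_arcosh (show 1 ≤ y + 1 by linarith)]
  have := lintegral_image_eq_lintegral_abs_deriv_mul measurableSet_Ioi
    (fun x _ => ((Real.hasDerivAt_cosh x).sub_const 1).hasDerivWithinAt) hinj f
  rw [himg] at this
  rw [this]
  refine setLIntegral_congr_fun measurableSet_Ioi fun p hp => ?_
  simp only [abs_of_pos (Real.sinh_pos_iff.2 hp)]

theorem lintegral_eq_two_mul_lintegral_comp_two_mul {f : ℝ → ℝ≥0∞} (hf : Measurable f) :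
    ∫⁻ u, f u = 2 * ∫⁻ r, f (2 * r) := by
  conv_lhs => rw [← Real.smul_map_volume_mul_left (two_ne_zero (α := ℝ)), lintegral_smul_measure,
    lintegral_map hf (by fun_prop)]
  simp

theorem lintegral_lintegral_eq_two_mul_lintegral_add_sub {F : ℝ → ℝ → ℝ≥0∞}
    (hF : Measurable (Function.uncurry F)) :
    ∫⁻ t, ∫⁻ u, F t u = 2 * ∫⁻ r, ∫⁻ s, F (s + r) (s - r) := by
  have inner (t : ℝ) : ∫⁻ u, F t u = 2 * ∫⁻ r, F t (t - 2 * r) := by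
    rw [← lintegral_sub_left_eq_self _ t]
    exact lintegral_eq_two_mul_lintegral_comp_two_mul (f := fun u => F t (t - u))
      (hF.comp (f := fun u => (t, t - u)) (by fun_prop))
  simp_rw [inner]
  rw [lintegral_const_mul' _ _ (by simp), lintegral_lintegral_swap]
  · congr 1
    refine lintegral_congr fun r => ?_
    rw [← lintegral_add_right_eq_self _ r]
    refine lintegral_congr fun s => ?_
    ring_nf
  · exact (hF.comp (f := fun z : ℝ × ℝ => (z.1, z.1 - 2 * z.2)) (by fun_prop)).aemeasurable

theorem lintegral_mul_sq_lintegral {μ : Measure ℝ} [SFinite μ] {u W : ℝ → ℝ≥0∞} {g : ℝ → ℝ → ℝ≥0∞}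
    (hu : Measurable u) (hW : Measurable W) (hg : Measurable (Function.uncurry g)) :
    ∫⁻ x, u x * (∫⁻ r, W r * g x r) ^ 2 ∂μ
      = ∫⁻ r, ∫⁻ t, W r * W t * ∫⁻ x, u x * (g x r * g x t) ∂μ := by
  have hgx (x : ℝ) : Measurable (g x) := hg.comp (f := fun r => (x, r)) (by fun_prop)
  have hgr (r : ℝ) : Measurable (fun x => g x r) := hg.comp (f := fun x => (x, r)) (by fun_prop)
  have h1 (x : ℝ) : u x * (∫⁻ r, W r * g x r) ^ 2
      = ∫⁻ r, ∫⁻ t, W r * W t * (u x * (g x r * g x t)) := by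
    have hm : Measurable (fun r => W r * g x r) := hW.mul (hgx x)
    rw [sq, ← lintegral_lintegral_mul hm.aemeasurable hm.aemeasurable, ← lintegral_const_mul]
    · refine lintegral_congr fun r => ?_
      rw [← lintegral_const_mul _ (by fun_prop)]
      refine lintegral_congr fun t => ?_
      ring
    · refine Measurable.lintegral_prod_right'
        (f := fun z : ℝ × ℝ => W z.1 * g x z.1 * (W z.2 * g x z.2)) ?_
      fun_prop
  simp_rw [h1]
  have m3 : Measurable (fun z : (ℝ × ℝ) × ℝ =>
      W z.1.2 * W z.2 * (u z.1.1 * (g z.1.1 z.1.2 * g z.1.1 z.2))) := by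
    have a1 : Measurable (fun z : (ℝ × ℝ) × ℝ => g z.1.1 z.1.2) :=
      hg.comp (f := fun z : (ℝ × ℝ) × ℝ => (z.1.1, z.1.2)) (by fun_prop)
    have a2 : Measurable (fun z : (ℝ × ℝ) × ℝ => g z.1.1 z.2) :=
      hg.comp (f := fun z : (ℝ × ℝ) × ℝ => (z.1.1, z.2)) (by fun_prop)
    fun_prop
  rw [lintegral_lintegral_swap]
  · refine lintegral_congr fun r => ?_
    rw [lintegral_lintegral_swap]
    · refine lintegral_congr fun t => ?_
      rw [lintegral_const_mul]
      exact hu.mul ((hgr r).mul (hgr t))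
    · exact (m3.comp (f := fun z : ℝ × ℝ => ((z.1, r), z.2)) (by fun_prop)).aemeasurable
  · exact (Measurable.lintegral_prod_right' m3).aemeasurable

theorem lintegral_exp_mul_div_exp_add {s c : ℝ} (hs0 : 0 < s) (hs1 : s < 1) (hc : 0 < c) :
    ∫⁻ q : ℝ, ENNReal.ofReal (exp (s * q) / (exp q + c))
      = ENNReal.ofReal (c ^ (s - 1) * (π / sin (π * s))) := by
  have hΓ : 0 < Gamma s := Gamma_pos_of_pos hs0
  calc ∫⁻ q : ℝ, ENNReal.ofReal (exp (s * q) / (exp q + c))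
      = ∫⁻ q : ℝ, ∫⁻ τ in Set.Ioi (0:ℝ),
          ENNReal.ofReal (exp (s * q) * exp (-((exp q + c) * τ))) := by
        refine lintegral_congr fun q => ?_
        simp_rw [ENNReal.ofReal_mul (exp_pos (s * q)).le]
        rw [lintegral_const_mul' _ _ (by simp), lintegral_exp_neg_mul_Ioi (by positivity),
          ← ENNReal.ofReal_mul (exp_pos _).le, mul_one_div]
    _ = ∫⁻ τ in Set.Ioi (0:ℝ), ∫⁻ q : ℝ,
          ENNReal.ofReal (exp (s * q) * exp (-((exp q + c) * τ))) :=
        lintegral_lintegral_swap (by fun_prop)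
    _ = ∫⁻ τ in Set.Ioi (0:ℝ),
          ENNReal.ofReal (Gamma s) * ENNReal.ofReal (τ ^ ((1 - s) - 1) * exp (-(c * τ))) := by
        refine setLIntegral_congr_fun measurableSet_Ioi fun τ hτ => ?_
        have hτ : 0 < τ := hτ
        have h := lintegral_rpow_mul_exp_neg_mul_Ioi hs0 hτ
        rw [lintegral_Ioi_eq_lintegral_comp_exp] at h
        have e1 (q : ℝ) : ENNReal.ofReal (exp (s * q) * exp (-((exp q + c) * τ)))
            = ENNReal.ofReal (exp (-(c * τ))) * (ENNReal.ofReal (exp q) *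
              ENNReal.ofReal (exp q ^ (s - 1) * exp (-(τ * exp q)))) := by
          rw [← ENNReal.ofReal_mul (exp_pos _).le, ← ENNReal.ofReal_mul (exp_pos _).le,
            ← Real.exp_mul, ← Real.exp_add, ← Real.exp_add, ← Real.exp_add, ← Real.exp_add]
          ring_nf
        simp only [e1]
        rw [lintegral_const_mul' _ _ (by simp), h, ← ENNReal.ofReal_mul (exp_pos _).le,
          ← ENNReal.ofReal_mul hΓ.le]
        congr 1
        rw [one_div, Real.inv_rpow hτ.le, ← Real.rpow_neg hτ.le]
        ring_nf
    _ = ENNReal.ofReal (c ^ (s - 1) * (π / sin (π * s))) := by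
        rw [lintegral_const_mul' _ _ (by simp),
          lintegral_rpow_mul_exp_neg_mul_Ioi (by linarith) hc, ← ENNReal.ofReal_mul hΓ.le,
          ← Real.Gamma_mul_Gamma_one_sub, one_div, Real.inv_rpow hc.le, ← Real.rpow_neg hc.le]
        ring_nf

theorem lintegral_exp_mul_div_cosh_add_cosh {α p : ℝ} (hα0 : 0 < α) (hα1 : α < 1) (hp : 0 < p) :
    ∫⁻ q : ℝ, ENNReal.ofReal (exp (α * q) / (cosh q + cosh p))
      = ENNReal.ofReal (2 * π * sinh (α * p) / (sin (π * α) * sinh p)) := by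
  have hsin : 0 < sin (π * α) := sin_pos_of_pos_of_lt_pi (by positivity) (by nlinarith [pi_pos])
  have hsp : 0 < sinh p := Real.sinh_pos_iff.2 hp
  have hsa : 0 < sinh (α * p) := Real.sinh_pos_iff.2 (by positivity)
  have beta (c : ℝ) : ∫⁻ q : ℝ, ENNReal.ofReal (exp c / sinh p * (exp (α * q) / (exp q + exp c)))
      = ENNReal.ofReal (exp (α * c) * π / (sin (π * α) * sinh p)) := by
    simp_rw [ENNReal.ofReal_mul (div_pos (exp_pos c) hsp).le]
    rw [lintegral_const_mul' _ _ (by simp), lintegral_exp_mul_div_exp_add hα0 hα1 (exp_pos c),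
      ← ENNReal.ofReal_mul (by positivity), ← Real.exp_mul,
      show α * c = c + c * (α - 1) by ring, Real.exp_add]
    congr 1
    field_simp
  have split (q : ℝ) : exp (α * q) / (cosh q + cosh p)
        + exp (-p) / sinh p * (exp (α * q) / (exp q + exp (-p)))
      = exp p / sinh p * (exp (α * q) / (exp q + exp p)) := by
    have h1 : (0:ℝ) < exp q := exp_pos q
    have h2 : (0:ℝ) < exp p := exp_pos p
    have h3 : 0 < exp p ^ 2 - 1 := by
      have := Real.one_lt_exp_iff.2 hp
      nlinarith
    rw [Real.cosh_eq, Real.cosh_eq, Real.sinh_eq, Real.exp_neg, Real.exp_neg]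
    have h4 : exp p - (exp p)⁻¹ = (exp p ^ 2 - 1) / exp p := by field_simp
    have h5 : (exp q + (exp q)⁻¹) / 2 + (exp p + (exp p)⁻¹) / 2
        = (exp q + exp p) * (exp q * exp p + 1) / (2 * exp q * exp p) := by
      field_simp
      ring
    have h6 : exp q + (exp p)⁻¹ = (exp q * exp p + 1) / exp p := by field_simp
    rw [h4, h5, h6]
    field_simp
    ring
  have key := beta p
  simp_rw [← split] at key
  have hadd : ∀ q, ENNReal.ofReal (exp (α * q) / (cosh q + cosh p)
        + exp (-p) / sinh p * (exp (α * q) / (exp q + exp (-p))))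
      = ENNReal.ofReal (exp (α * q) / (cosh q + cosh p))
        + ENNReal.ofReal (exp (-p) / sinh p * (exp (α * q) / (exp q + exp (-p)))) := fun q => by
    have := Real.cosh_pos q
    have := Real.cosh_pos p
    exact ENNReal.ofReal_add (by positivity) (by positivity)
  simp_rw [hadd] at key
  rw [lintegral_add_left (by fun_prop), beta] at key
  have hval : ENNReal.ofReal (exp (α * p) * π / (sin (π * α) * sinh p))
      = ENNReal.ofReal (2 * π * sinh (α * p) / (sin (π * α) * sinh p))
        + ENNReal.ofReal (exp (α * -p) * π / (sin (π * α) * sinh p)) := by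
    rw [← ENNReal.ofReal_add (by positivity) (by positivity), ← add_div, Real.sinh_eq (α * p)]
    congr 2
    ring_nf
  rw [hval] at key
  exact (ENNReal.add_left_inj (by simp)).1 key

theorem lintegral_exp_neg_mul_cosh {x : ℝ} (hx : 0 < x) (s : ℝ) :
    ∫⁻ r : ℝ, ENNReal.ofReal (exp (-x * (2 * cosh s * cosh r)))
      = ∫⁻ r : ℝ, ENNReal.ofReal (exp (-(2 * cosh s ^ 2 * exp r) - exp (-r) * x ^ 2 / 2)) := by
  have hs := Real.cosh_pos s
  rw [← lintegral_add_right_eq_self _ (log (2 * cosh s / x))]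
  refine lintegral_congr fun r => ?_
  rw [Real.cosh_eq (r + _), neg_add, Real.exp_add, Real.exp_add, Real.exp_neg (log _),
    Real.exp_log (by positivity)]
  congr 2
  field_simp
  ring

/-- The density of the Gaussian `exp (-exp (-r) * x ^ 2 / 2)` in the representation of
`besselK α x ^ 2` as a mixture of Gaussians. -/
noncomputable def besselKSqWeight (α r : ℝ) : ℝ≥0∞ :=
  ∫⁻ s : ℝ, ENNReal.ofReal (exp (2 * α * s - 2 * cosh s ^ 2 * exp r))

theorem measurable_besselKSqWeight (α : ℝ) : Measurable (besselKSqWeight α) :=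
  Measurable.lintegral_prod_right'
    (f := fun z : ℝ × ℝ => ENNReal.ofReal (exp (2 * α * z.2 - 2 * cosh z.2 ^ 2 * exp z.1)))
    (by fun_prop)

theorem sq_lintegral_exp_neg_mul_cosh_add {x : ℝ} (hx : 0 < x) (α : ℝ) :
    (∫⁻ t : ℝ, ENNReal.ofReal (exp (-x * cosh t + α * t))) ^ 2
      = 2 * ∫⁻ r, besselKSqWeight α r * ENNReal.ofReal (exp (-(exp (-r) * x ^ 2 / 2))) := by
  rw [sq, ← lintegral_lintegral_mul (by fun_prop) (by fun_prop),
    lintegral_lintegral_eq_two_mul_lintegral_add_sub (by fun_prop)]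
  have e1 (r s : ℝ) : ENNReal.ofReal (exp (-x * cosh (s + r) + α * (s + r)))
        * ENNReal.ofReal (exp (-x * cosh (s - r) + α * (s - r)))
      = ENNReal.ofReal (exp (2 * α * s)) * ENNReal.ofReal (exp (-x * (2 * cosh s * cosh r))) := by
    rw [← ENNReal.ofReal_mul (exp_pos _).le, ← ENNReal.ofReal_mul (exp_pos _).le, ← Real.exp_add,
      ← Real.exp_add, Real.cosh_add, Real.cosh_sub]
    ring_nf
  have e2 (r s : ℝ) : ENNReal.ofReal (exp (2 * α * s))
        * ENNReal.ofReal (exp (-(2 * cosh s ^ 2 * exp r) - exp (-r) * x ^ 2 / 2))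
      = ENNReal.ofReal (exp (2 * α * s - 2 * cosh s ^ 2 * exp r))
        * ENNReal.ofReal (exp (-(exp (-r) * x ^ 2 / 2))) := by
    rw [← ENNReal.ofReal_mul (exp_pos _).le, ← ENNReal.ofReal_mul (exp_pos _).le, ← Real.exp_add,
      ← Real.exp_add]
    ring_nf
  simp_rw [e1]
  rw [lintegral_lintegral_swap (by fun_prop)]
  congr 1
  calc _ = ∫⁻ s : ℝ, ∫⁻ r : ℝ, ENNReal.ofReal (exp (2 * α * s - 2 * cosh s ^ 2 * exp r))
        * ENNReal.ofReal (exp (-(exp (-r) * x ^ 2 / 2))) := by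
        refine lintegral_congr fun s => ?_
        simp_rw [← e2]
        rw [lintegral_const_mul' _ _ (by simp), lintegral_const_mul' _ _ (by simp),
          lintegral_exp_neg_mul_cosh hx]
    _ = _ := by
        rw [lintegral_lintegral_swap (by fun_prop)]
        refine lintegral_congr fun r => ?_
        rw [lintegral_mul_const' _ _ (by simp), besselKSqWeight]

theorem lintegral_besselKSqWeight_mul_exp {α p : ℝ} (hα0 : 0 < α) (hα1 : α < 1) (hp : 0 < p) :
    ∫⁻ r, besselKSqWeight α r
        * ENNReal.ofReal (exp r * exp (-((exp r) * (cosh p - 1))))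
      = ENNReal.ofReal (π * sinh (α * p) / (sin (π * α) * sinh p)) := by
  have hcp := Real.one_lt_cosh.2 hp.ne'
  calc ∫⁻ r, besselKSqWeight α r * ENNReal.ofReal (exp r * exp (-((exp r) * (cosh p - 1))))
      = ∫⁻ r : ℝ, ∫⁻ s : ℝ, ENNReal.ofReal (exp (2 * α * s))
          * (ENNReal.ofReal (exp r) * ENNReal.ofReal (exp (-((cosh (2 * s) + cosh p) * exp r)))) := by
        refine lintegral_congr fun r => ?_
        rw [besselKSqWeight, ← lintegral_mul_const' _ _ (by simp)]
        refine lintegral_congr fun s => ?_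
        rw [← ENNReal.ofReal_mul (exp_pos _).le, ← ENNReal.ofReal_mul (exp_pos _).le,
          ← ENNReal.ofReal_mul (exp_pos _).le, ← Real.exp_add, ← Real.exp_add, ← Real.exp_add,
          ← Real.exp_add, Real.cosh_two_mul, Real.sinh_sq]
        ring_nf
    _ = ∫⁻ s : ℝ, ENNReal.ofReal (exp (2 * α * s)) * ∫⁻ r : ℝ,
          ENNReal.ofReal (exp r) * ENNReal.ofReal (exp (-((cosh (2 * s) + cosh p) * exp r))) := by
        rw [lintegral_lintegral_swap (by fun_prop)]
        refine lintegral_congr fun s => ?_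
        rw [lintegral_const_mul' _ _ (by simp)]
    _ = ∫⁻ s : ℝ, ENNReal.ofReal (exp (α * (2 * s)) / (cosh (2 * s) + cosh p)) := by
        refine lintegral_congr fun s => ?_
        have := Real.cosh_pos (2 * s)
        rw [← lintegral_Ioi_eq_lintegral_comp_exp
            (fun y => ENNReal.ofReal (exp (-((cosh (2 * s) + cosh p) * y)))),
          lintegral_exp_neg_mul_Ioi (by linarith), ← ENNReal.ofReal_mul (exp_pos _).le,
          mul_one_div, mul_left_comm, mul_assoc]
    _ = _ := by
        have h := lintegral_exp_mul_div_cosh_add_cosh hα0 hα1 hp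
        rw [lintegral_eq_two_mul_lintegral_comp_two_mul (by fun_prop), mul_assoc, mul_div_assoc,
          ENNReal.ofReal_mul zero_le_two, ENNReal.ofReal_ofNat] at h
        exact (ENNReal.mul_right_inj (by simp) (by simp)).1 h

theorem lintegral_mul_sq_lintegral_besselKSqWeight {α : ℝ} (hα0 : 0 < α) (hα1 : α < 1) :
    ∫⁻ x in Set.Ioi (0:ℝ), ENNReal.ofReal x
        * (∫⁻ r, besselKSqWeight α r * ENNReal.ofReal (exp (-(exp (-r) * x ^ 2 / 2)))) ^ 2
      = ∫⁻ p in Set.Ioi (0:ℝ),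
          ENNReal.ofReal ((π / sin (π * α)) ^ 2 * (sinh (α * p) ^ 2 / sinh p)) := by
  have hsin : 0 < sin (π * α) := sin_pos_of_pos_of_lt_pi (by positivity) (by nlinarith [pi_pos])
  have hW := measurable_besselKSqWeight α
  rw [lintegral_mul_sq_lintegral (by fun_prop) hW (by fun_prop)]
  have hker (r t : ℝ) : ∫⁻ x in Set.Ioi (0:ℝ), ENNReal.ofReal x
        * (ENNReal.ofReal (exp (-(exp (-r) * x ^ 2 / 2)))
          * ENNReal.ofReal (exp (-(exp (-t) * x ^ 2 / 2))))
      = ∫⁻ κ in Set.Ioi (0:ℝ), 1 * (ENNReal.ofReal (exp r * exp (-(exp r * κ)))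
          * ENNReal.ofReal (exp t * exp (-(exp t * κ)))) := by
    have e1 : ∀ x ∈ Set.Ioi (0:ℝ), ENNReal.ofReal x
          * (ENNReal.ofReal (exp (-(exp (-r) * x ^ 2 / 2)))
            * ENNReal.ofReal (exp (-(exp (-t) * x ^ 2 / 2))))
        = ENNReal.ofReal (x * exp (-((exp (-r) + exp (-t)) * x ^ 2 / 2))) := fun x hx => by
      have hx : 0 < x := hx
      rw [← ENNReal.ofReal_mul (exp_pos _).le, ← ENNReal.ofReal_mul hx.le, ← Real.exp_add]
      ring_nf
    have e2 (κ : ℝ) : 1 * (ENNReal.ofReal (exp r * exp (-(exp r * κ)))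
          * ENNReal.ofReal (exp t * exp (-(exp t * κ))))
        = ENNReal.ofReal (exp r * exp t) * ENNReal.ofReal (exp (-((exp r + exp t) * κ))) := by
      rw [one_mul, ← ENNReal.ofReal_mul (by positivity), ← ENNReal.ofReal_mul (by positivity),
        ← Real.exp_add, ← Real.exp_add, ← Real.exp_add, ← Real.exp_add, ← Real.exp_add]
      ring_nf
    rw [setLIntegral_congr_fun measurableSet_Ioi e1,
      lintegral_mul_exp_neg_mul_sq_Ioi (by positivity)]
    simp_rw [e2]
    rw [lintegral_const_mul' _ _ (by simp), lintegral_exp_neg_mul_Ioi (by positivity),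
      ← ENNReal.ofReal_mul (by positivity), Real.exp_neg, Real.exp_neg]
    congr 1
    field_simp
    ring
  simp_rw [hker]
  rw [← lintegral_mul_sq_lintegral (u := fun _ => 1)
    (g := fun κ r => ENNReal.ofReal (exp r * exp (-(exp r * κ)))) (by fun_prop) hW (by fun_prop),
    lintegral_Ioi_eq_lintegral_comp_cosh_sub_one]
  refine setLIntegral_congr_fun measurableSet_Ioi fun p hp => ?_
  have hp : 0 < p := hp
  have hsp : 0 < sinh p := Real.sinh_pos_iff.2 hp
  have hsa : 0 < sinh (α * p) := Real.sinh_pos_iff.2 (by positivity)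
  simp only [lintegral_besselKSqWeight_mul_exp hα0 hα1 hp]
  rw [one_mul, ← ENNReal.ofReal_pow (by positivity), ← ENNReal.ofReal_mul hsp.le]
  congr 1
  field_simp

theorem differentiableAt_log_Gamma {x : ℝ} (hx : 0 < x) :
    DifferentiableAt ℝ (fun y => log (Gamma y)) x :=
  (Real.differentiableAt_Gamma fun m =>
    ((neg_nonpos.2 m.cast_nonneg).trans_lt hx).ne').log (Gamma_pos_of_pos hx).ne'

theorem digamma_add_one {x : ℝ} (hx : 0 < x) : digamma (x + 1) = digamma x + 1 / x := by
  have h : (fun y => log (Gamma (y + 1))) =ᶠ[nhds x] fun y => log y + log (Gamma y) := by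
    filter_upwards [lt_mem_nhds hx] with y hy
    rw [Real.Gamma_add_one hy.ne', Real.log_mul hy.ne' (Gamma_pos_of_pos hy).ne']
  have h' := h.deriv_eq
  rw [deriv_comp_add_const (f := fun y => log (Gamma y)),
    deriv_fun_add (Real.differentiableAt_log hx.ne') (differentiableAt_log_Gamma hx),
    Real.deriv_log] at h'
  rw [digamma, h', digamma]
  ring

theorem digamma_add_natCast {x : ℝ} (hx : 0 < x) (N : ℕ) :
    digamma (x + N) = digamma x + ∑ n ∈ Finset.range N, 1 / (n + x) := by
  induction N with
  | zero => simp
  | succ N ih =>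
    rw [Nat.cast_succ, ← add_assoc, digamma_add_one (by positivity), ih, Finset.sum_range_succ]
    ring

theorem monotoneOn_digamma : MonotoneOn digamma (Set.Ioi 0) :=
  Real.convexOn_log_Gamma.monotoneOn_deriv fun _ hx => differentiableAt_log_Gamma hx

theorem digamma_one_half : digamma (1 / 2) = -2 * log 2 - eulerMascheroniConstant := by
  have hs : √π ≠ 0 := (sqrt_pos.2 pi_pos).ne'
  have h := Real.hasDerivAt_Gamma_one_half.log (by rwa [Real.Gamma_one_half_eq])
  rw [digamma, h.deriv, Real.Gamma_one_half_eq]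
  field_simp
  ring

theorem hasSum_digamma_sub {x y : ℝ} (hx : 0 < x) (hxy : x ≤ y) (hyx : y ≤ x + 1) :
    HasSum (fun n : ℕ => 1 / (n + x) - 1 / (n + y)) (digamma y - digamma x) := by
  have hy : 0 < y := hx.trans_le hxy
  rw [hasSum_iff_tendsto_nat_of_nonneg fun n =>
    sub_nonneg.2 (one_div_le_one_div_of_le (by positivity) (by linarith))]
  have hpart (N : ℕ) : ∑ n ∈ Finset.range N, (1 / (n + x) - 1 / (n + y))
      = digamma y - digamma x - (digamma (y + N) - digamma (x + N)) := by
    rw [Finset.sum_sub_distrib, digamma_add_natCast hx, digamma_add_natCast hy]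
    ring
  have hlim : Filter.Tendsto (fun N : ℕ => digamma (y + N) - digamma (x + N)) Filter.atTop
      (nhds 0) := by
    refine squeeze_zero (g := fun N : ℕ => 1 / (x + N)) (fun N => ?_) (fun N => ?_) ?_
    · exact sub_nonneg.2 (monotoneOn_digamma (Set.mem_Ioi.2 (by positivity))
        (Set.mem_Ioi.2 (by positivity)) (by linarith))
    · have h := monotoneOn_digamma (Set.mem_Ioi.2 (show 0 < y + N by positivity))
        (Set.mem_Ioi.2 (show 0 < x + N + 1 by positivity)) (by linarith)
      rw [digamma_add_one (by positivity)] at h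
      linarith
    · exact tendsto_const_nhds.div_atTop
        (Filter.tendsto_atTop_add_const_left _ x tendsto_natCast_atTop_atTop)
  simp_rw [hpart]
  simpa using (tendsto_const_nhds (x := digamma y - digamma x)).sub hlim

theorem lintegral_sinh_sq_mul_exp {α b : ℝ} (hα : 2 * |α| < b) :
    ∫⁻ p in Set.Ioi (0:ℝ), ENNReal.ofReal (sinh (α * p) ^ 2 * (2 * exp (-b * p)))
      = ENNReal.ofReal (1 / 2 * (1 / (b - 2 * α) + 1 / (b + 2 * α)) - 1 / b) := by
  have hb : 0 < b := by linarith [abs_nonneg α]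
  have h1 : 0 < b - 2 * α := by linarith [le_abs_self α]
  have h2 : 0 < b + 2 * α := by linarith [neg_abs_le α]
  have hint {c : ℝ} (hc : 0 < c) : IntegrableOn (fun p => exp (-c * p)) (Set.Ioi 0) :=
    integrableOn_exp_mul_Ioi (by linarith) 0
  have hval {c : ℝ} (hc : 0 < c) : ∫ p in Set.Ioi (0:ℝ), exp (-c * p) = 1 / c := by
    rw [integral_exp_mul_Ioi (by linarith)]
    simp
  have e (p : ℝ) : sinh (α * p) ^ 2 * (2 * exp (-b * p))
      = 1 / 2 * (exp (-(b - 2 * α) * p) + exp (-(b + 2 * α) * p)) - exp (-b * p) := by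
    rw [show -(b - 2 * α) * p = -b * p + α * p + α * p by ring,
      show -(b + 2 * α) * p = -b * p + -(α * p) + -(α * p) by ring, Real.sinh_eq]
    simp only [Real.exp_add]
    have : exp (α * p) * exp (-(α * p)) = 1 := by rw [← Real.exp_add]; simp
    linear_combination (-exp (-b * p)) * this
  have hi : IntegrableOn (fun p => 1 / 2 * (exp (-(b - 2 * α) * p) + exp (-(b + 2 * α) * p)))
    (Set.Ioi 0) := ((hint h1).add (hint h2)).const_mul _
  rw [← ofReal_integral_eq_lintegral_ofReal]
  · simp_rw [e]
    rw [integral_sub hi (hint hb), integral_const_mul, integral_add (hint h1) (hint h2), hval h1,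
      hval h2, hval hb]
  · simp_rw [e]
    exact hi.sub (hint hb)
  · exact ae_of_all _ fun p => by positivity

theorem hasSum_two_mul_exp_neg_odd_mul {p : ℝ} (hp : 0 < p) :
    HasSum (fun n : ℕ => 2 * exp (-(2 * n + 1) * p)) (1 / sinh p) := by
  have hlt : exp (-2 * p) < 1 := by simpa using hp
  have h := (hasSum_geometric_of_lt_one (exp_pos (-2 * p)).le hlt).mul_left (2 * exp (-p))
  convert! h using 1
  · ext n
    rw [← Real.exp_nat_mul, mul_assoc, ← Real.exp_add]
    ring_nf
  · have h2 : exp (-2 * p) = exp (-p) * exp (-p) := by rw [← Real.exp_add]; ring_nf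
    have h3 : exp p * exp (-p) = 1 := by rw [← Real.exp_add]; simp
    have h4 : 0 < exp p - exp (-p) := sub_pos.2 (Real.exp_lt_exp.2 (by linarith))
    rw [Real.sinh_eq, ← div_eq_mul_inv, one_div_div, div_eq_div_iff h4.ne' (by linarith), h2]
    linear_combination -2 * h3

theorem half_mul_add_sub_nonneg {α b : ℝ} (hα : 2 * |α| < b) :
    0 ≤ 1 / 2 * (1 / (b - 2 * α) + 1 / (b + 2 * α)) - 1 / b := by
  have hb : 0 < b := by linarith [abs_nonneg α]
  have h1 : 0 < b - 2 * α := by linarith [le_abs_self α]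
  have h2 : 0 < b + 2 * α := by linarith [neg_abs_le α]
  have : 1 / 2 * (1 / (b - 2 * α) + 1 / (b + 2 * α)) - 1 / b
      = 4 * α ^ 2 / ((b - 2 * α) * (b + 2 * α) * b) := by
    field_simp
    ring
  rw [this]
  positivity

theorem hasSum_digamma_half_sub_add_half_add {α : ℝ} (hα0 : 0 < α) (hα1 : α < 1 / 2) :
    HasSum (fun n : ℕ => 1 / 2 * (1 / ((2 * n + 1) - 2 * α) + 1 / ((2 * n + 1) + 2 * α))
        - 1 / (2 * n + 1))
      (-(digamma (1 / 2 - α) + digamma (1 / 2 + α) + 4 * log 2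
        + 2 * eulerMascheroniConstant) / 4) := by
  have h := ((hasSum_digamma_sub (x := 1 / 2 - α) (y := 1 / 2) (by linarith) (by linarith)
    (by linarith)).sub (hasSum_digamma_sub (x := 1 / 2) (y := 1 / 2 + α) (by norm_num)
    (by linarith) (by linarith))).mul_left (1 / 4)
  convert! h using 1
  · ext n
    rw [show (2 * n + 1) - 2 * α = 2 * (n + (1 / 2 - α)) by ring,
      show (2 * n + 1) + 2 * α = 2 * (n + (1 / 2 + α)) by ring,
      show (2 * n + 1 : ℝ) = 2 * (n + 1 / 2) by ring]
    simp only [one_div, mul_inv]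
    ring
  · rw [digamma_one_half]
    ring

theorem two_mul_abs_lt_two_mul_natCast_add_one {α : ℝ} (hα : |α| < 1 / 2) (n : ℕ) :
    2 * |α| < 2 * n + 1 := by
  have : (0:ℝ) ≤ n := n.cast_nonneg
  linarith

theorem neg_digamma_half_sub_add_half_add_nonneg {α : ℝ} (hα0 : 0 < α) (hα1 : α < 1 / 2) :
    0 ≤ -(digamma (1 / 2 - α) + digamma (1 / 2 + α) + 4 * log 2
      + 2 * eulerMascheroniConstant) / 4 :=
  (hasSum_digamma_half_sub_add_half_add hα0 hα1).nonneg fun n => half_mul_add_sub_nonneg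
    (two_mul_abs_lt_two_mul_natCast_add_one (by rwa [abs_of_pos hα0]) n)

theorem lintegral_sinh_sq_div_sinh {α : ℝ} (hα0 : 0 < α) (hα1 : α < 1 / 2) :
    ∫⁻ p in Set.Ioi (0:ℝ), ENNReal.ofReal (sinh (α * p) ^ 2 / sinh p)
      = ENNReal.ofReal (-(digamma (1 / 2 - α) + digamma (1 / 2 + α) + 4 * log 2
        + 2 * eulerMascheroniConstant) / 4) := by
  have hsum := hasSum_digamma_half_sub_add_half_add hα0 hα1
  have habs := two_mul_abs_lt_two_mul_natCast_add_one (by rwa [abs_of_pos hα0] : |α| < 1 / 2)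
  have hexp : ∀ p ∈ Set.Ioi (0:ℝ), ENNReal.ofReal (sinh (α * p) ^ 2 / sinh p)
      = ∑' n : ℕ, ENNReal.ofReal (sinh (α * p) ^ 2 * (2 * exp (-(2 * n + 1) * p))) := fun p hp => by
    have h := (hasSum_two_mul_exp_neg_odd_mul (Set.mem_Ioi.1 hp)).mul_left (sinh (α * p) ^ 2)
    rw [← ENNReal.ofReal_tsum_of_nonneg (fun n => by positivity) h.summable, h.tsum_eq,
      mul_one_div]
  rw [setLIntegral_congr_fun measurableSet_Ioi hexp, lintegral_tsum fun n => by fun_prop]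
  simp_rw [lintegral_sinh_sq_mul_exp (habs _)]
  rw [← ENNReal.ofReal_tsum_of_nonneg (fun n => half_mul_add_sub_nonneg (habs n)) hsum.summable,
    hsum.tsum_eq]

theorem integrable_exp_neg_mul_cosh_add {x : ℝ} (hx : 0 < x) (α : ℝ) :
    Integrable fun t : ℝ => exp (-x * cosh t + α * t) := by
  refine ((integrable_exp_neg_mul_sq (show 0 < x / 4 by positivity)).const_mul
    (exp (α ^ 2 / x))).mono' (by fun_prop) (ae_of_all _ fun t => ?_)
  rw [Real.norm_eq_abs, abs_of_pos (exp_pos _), ← Real.exp_add, Real.exp_le_exp]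
  have h1 : 1 + t ^ 2 / 2 ≤ cosh t := by
    have h0 : |t| / 2 ≤ sinh (|t| / 2) := Real.self_le_sinh_iff.2 (by positivity)
    have hc : cosh t = 1 + 2 * sinh (|t| / 2) ^ 2 := by
      rw [← Real.cosh_abs, show |t| = 2 * (|t| / 2) by ring, Real.cosh_two_mul, Real.cosh_sq]
      ring_nf
    rw [hc, ← sq_abs t]
    nlinarith [abs_nonneg t]
  have h2 : α * t ≤ α ^ 2 / x + x / 4 * t ^ 2 := by
    rw [← sub_nonneg, show α ^ 2 / x + x / 4 * t ^ 2 - α * t = (α - x / 2 * t) ^ 2 / x by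
      field_simp; ring]
    positivity
  nlinarith

theorem ofReal_besselK {x : ℝ} (hx : 0 < x) (α : ℝ) :
    ENNReal.ofReal (besselK α x)
      = 2⁻¹ * ∫⁻ t : ℝ, ENNReal.ofReal (exp (-x * cosh t + α * t)) := by
  have hi := integrable_exp_neg_mul_cosh_add hx α
  have h : besselK α x = 2⁻¹ * ∫ t : ℝ, exp (-x * cosh t + α * t) := by
    rw [← intervalIntegral.integral_Iic_add_Ioi hi.integrableOn hi.integrableOn (b := 0),
      ← neg_zero, ← integral_comp_neg_Ioi, neg_zero,
      ← integral_add hi.comp_neg.integrableOn hi.integrableOn, ← integral_const_mul, besselK]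
    congr 1 with t
    rw [Real.cosh_neg, Real.exp_add, Real.exp_add, Real.cosh_eq (α * t)]
    ring_nf
  rw [h, ENNReal.ofReal_mul (by norm_num), ofReal_integral_eq_lintegral_ofReal hi
    (ae_of_all _ fun _ => (exp_pos _).le), ENNReal.ofReal_inv_of_pos two_pos, ENNReal.ofReal_ofNat]

theorem besselK_nonneg (α x : ℝ) : 0 ≤ besselK α x :=
  integral_nonneg fun _ => mul_nonneg (exp_pos _).le (cosh_pos _).le

theorem besselK_neg (α x : ℝ) : besselK (-α) x = besselK α x := by
  simp [besselK]

theorem measurable_besselK (α : ℝ) : Measurable (besselK α) :=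
  (StronglyMeasurable.integral_prod_right'
    (f := fun z : ℝ × ℝ => exp (-z.1 * cosh z.2) * cosh (α * z.2))
    (by fun_prop : Measurable _).stronglyMeasurable).measurable

theorem integral_mul_besselK_pow_four {α : ℝ} (hα0 : 0 < α) (hα1 : α < 1 / 2) :
    ∫ x in Set.Ioi (0:ℝ), x * besselK α x ^ 4
      = -(π ^ 2 / 16) * (1 / sin (π * α)) ^ 2 *
        (digamma (1 / 2 - α) + digamma (1 / 2 + α) + 4 * log 2 + 2 * eulerMascheroniConstant) := by
  have hK := measurable_besselK α
  have hnn : ∀ x ∈ Set.Ioi (0:ℝ), 0 ≤ x * besselK α x ^ 4 := fun x hx =>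
    mul_nonneg (Set.mem_Ioi.1 hx).le (pow_nonneg (besselK_nonneg α x) 4)
  have e : ∀ x ∈ Set.Ioi (0:ℝ), ENNReal.ofReal (x * besselK α x ^ 4)
      = 4⁻¹ * (ENNReal.ofReal x * (∫⁻ r, besselKSqWeight α r
          * ENNReal.ofReal (exp (-(exp (-r) * x ^ 2 / 2)))) ^ 2) := fun x hx => by
    have hx : 0 < x := hx
    have h4 : (2⁻¹ : ℝ≥0∞) ^ 4 * 2 ^ 2 = 4⁻¹ := by
      rw [pow_add (2⁻¹ : ℝ≥0∞) 2 2, mul_assoc, ← mul_pow, ENNReal.inv_mul_cancel (by simp) (by simp),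
        one_pow, mul_one, ← ENNReal.inv_pow]
      norm_num
    rw [ENNReal.ofReal_mul hx.le, ENNReal.ofReal_pow (besselK_nonneg α x), ofReal_besselK hx,
      mul_pow, show 4 = 2 * 2 from rfl, pow_mul (lintegral _ _), sq_lintegral_exp_neg_mul_cosh_add hx,
      mul_pow, ← h4]
    ring
  rw [integral_eq_lintegral_of_nonneg_ae (ae_restrict_of_forall_mem measurableSet_Ioi hnn)
    (by fun_prop), setLIntegral_congr_fun measurableSet_Ioi e, lintegral_const_mul' _ _ (by simp),
    lintegral_mul_sq_lintegral_besselKSqWeight hα0 (by linarith)]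
  simp_rw [ENNReal.ofReal_mul (sq_nonneg (π / sin (π * α)))]
  rw [lintegral_const_mul' _ _ (by simp), lintegral_sinh_sq_div_sinh hα0 hα1, ENNReal.toReal_mul,
    ENNReal.toReal_mul, ENNReal.toReal_ofReal (sq_nonneg _), ENNReal.toReal_ofReal]
  · simp
    ring
  · exact neg_digamma_half_sub_add_half_add_nonneg hα0 hα1

theorem stmt4 (a α : ℝ) (ha : 0 < a) (hα0 : α ≠ 0) (hα : |α| < 1 / 2) :
    (∫ x in Set.Ioi (0:ℝ), x * (besselK α (a * x)) ^ 4)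
    = -(π ^ 2 / (16 * a ^ 2)) * (1 / Real.sin (π * α)) ^ 2 *
      (digamma (1 / 2 - α) + digamma (1 / 2 + α) + 4 * Real.log 2
        + 2 * Real.eulerMascheroniConstant) := by
  have hscale : ∫ x in Set.Ioi (0:ℝ), x * (besselK α (a * x)) ^ 4
      = 1 / a ^ 2 * ∫ x in Set.Ioi (0:ℝ), x * besselK α x ^ 4 := by
    have h := integral_comp_mul_left_Ioi (fun x => x * besselK α x ^ 4) 0 ha
    simp only [mul_assoc, integral_const_mul, mul_zero, smul_eq_mul] at h
    rw [eq_comm, ← mul_right_inj' ha.ne', h]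
    field_simp
  rw [hscale]
  rcases hα0.lt_or_gt with hneg | hpos
  · have h := integral_mul_besselK_pow_four (neg_pos.2 hneg) (by rwa [abs_of_neg hneg] at hα)
    simp only [besselK_neg, mul_neg, sin_neg, sub_neg_eq_add, ← sub_eq_add_neg] at h
    rw [h]
    field_simp
    ring
  · rw [integral_mul_besselK_pow_four hpos (by rwa [abs_of_pos hpos] at hα)]
    field_simp
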